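/- Let A be a real n×n matrix and B a real n×r matrix such that the controllability matrix [B, AB, A²B, …, A^{n−1}B] has rank n. Then there exists a real r×n matrix C such that all eigenvalues of A + BC have negative real part. -/

import Mathlib

open Matrix

namespace Matrix

variable {n m : Type*} [Fintype n] [Fintype m]

theorem dotProduct_mulVec_comm_of_isSymm {W : Matrix n n ℝ} (hW : W.IsSymm) (x y : n → ℝ) :
    x ⬝ᵥ W *ᵥ y = y ⬝ᵥ W *ᵥ x := by
  rw [dotProduct_mulVec, ← mulVec_transpose, hW.eq, dotProduct_comm]

variable [DecidableEq n]

/-- Lyapunov's criterion: if `K W + W Kᵀ = s W - Q` with `W` positive definite, `Q` positive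
semidefinite and `s < 0`, then all complex eigenvalues of `K` have negative real part. -/
theorem re_neg_of_mem_spectrum_of_lyapunov {K W Q : Matrix n n ℝ} {s : ℝ} (hs : s < 0)
    (hW : W.PosDef) (hQ : Q.PosSemidef) (h : K * W + W * Kᵀ = s • W - Q)
    {μ : ℂ} (hμ : μ ∈ spectrum ℂ (K.map Complex.ofReal)) : μ.re < 0 := by
  have hWs : W.IsSymm := hW.isHermitian
  have hdet : (algebraMap ℂ (Matrix n n ℂ) μ - K.map Complex.ofReal).det = 0 := by
    rw [spectrum.mem_iff, isUnit_iff_isUnit_det, isUnit_iff_ne_zero, not_not] at hμ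
    exact hμ
  obtain ⟨v, hv0, hv⟩ := exists_vecMul_eq_zero_iff.mpr hdet
  have hvK : v ᵥ* K.map Complex.ofReal = μ • v := by
    rw [vecMul_sub, sub_eq_zero, Algebra.algebraMap_eq_smul_one, vecMul_smul, vecMul_one] at hv
    exact hv.symm
  set x : n → ℝ := fun i => (v i).re with hx
  set y : n → ℝ := fun i => (v i).im with hy
  have hxK : x ᵥ* K = μ.re • x - μ.im • y := by
    ext i
    have := congrArg Complex.re (congrFun hvK i)
    simpa [vecMul, dotProduct, hx, hy] using this
  have hyK : y ᵥ* K = μ.re • y + μ.im • x := by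
    ext i
    have := congrArg Complex.im (congrFun hvK i)
    simpa [vecMul, dotProduct, hx, hy] using this
  have hform (z : n → ℝ) :
      2 * ((z ᵥ* K) ⬝ᵥ W *ᵥ z) = s * (z ⬝ᵥ W *ᵥ z) - z ⬝ᵥ Q *ᵥ z := by
    have hz := congrArg (fun M : Matrix n n ℝ => z ⬝ᵥ M *ᵥ z) h
    simp only [add_mulVec, sub_mulVec, smul_mulVec, dotProduct_add, dotProduct_sub,
      dotProduct_smul, smul_eq_mul, ← mulVec_mulVec, mulVec_transpose] at hz
    rw [dotProduct_mulVec z K, dotProduct_mulVec_comm_of_isSymm hWs z] at hz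
    linarith
  have hsymm := dotProduct_mulVec_comm_of_isSymm hWs x y
  have hfx := hform x
  have hfy := hform y
  simp only [hxK, hyK, sub_dotProduct, add_dotProduct, smul_dotProduct, smul_eq_mul] at hfx hfy
  have hQx : 0 ≤ x ⬝ᵥ Q *ᵥ x := hQ.dotProduct_mulVec_nonneg x
  have hQy : 0 ≤ y ⬝ᵥ Q *ᵥ y := hQ.dotProduct_mulVec_nonneg y
  have hWx : 0 ≤ x ⬝ᵥ W *ᵥ x := hW.posSemidef.dotProduct_mulVec_nonneg x
  have hWy : 0 ≤ y ⬝ᵥ W *ᵥ y := hW.posSemidef.dotProduct_mulVec_nonneg y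
  have hpos : 0 < x ⬝ᵥ W *ᵥ x + y ⬝ᵥ W *ᵥ y := by
    by_cases hx0 : x = 0
    · have hy0 : y ≠ 0 := by
        intro hy0
        exact hv0 (funext fun i => Complex.ext (congrFun hx0 i) (congrFun hy0 i))
      exact add_pos_of_nonneg_of_pos hWx (hW.dotProduct_mulVec_pos hy0)
    · exact add_pos_of_pos_of_nonneg (hW.dotProduct_mulVec_pos hx0) hWy
  rw [hsymm] at hfy
  by_contra! hre
  nlinarith [mul_nonneg hre hpos.le, mul_pos (neg_pos.mpr hs) hpos]

/-- A solution of the Lyapunov equation with right-hand side bounded by `B Bᵀ` yields a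
stabilizing feedback. -/
theorem exists_feedback_of_lyapunov {A W G : Matrix n n ℝ} {B : Matrix n m ℝ} {s : ℝ} (hs : s < 0)
    (hW : W.PosDef) (hG : G.PosSemidef) (h : A * W + W * Aᵀ = s • W + B * Bᵀ - G) :
    ∃ C : Matrix m n ℝ, ∀ μ ∈ spectrum ℂ ((A + B * C).map Complex.ofReal), μ.re < 0 := by
  have hBB : (B * Bᵀ).PosSemidef := by simpa using posSemidef_self_mul_conjTranspose B
  have hdet : IsUnit W.det := (isUnit_iff_isUnit_det W).mp hW.isUnit
  have hWt : Wᵀ = W := hW.isHermitian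
  refine ⟨-(Bᵀ * W⁻¹), fun μ hμ => re_neg_of_mem_spectrum_of_lyapunov hs hW (hBB.add hG) ?_ hμ⟩
  have h₁ : B * -(Bᵀ * W⁻¹) * W = -(B * Bᵀ) := by
    rw [Matrix.mul_neg, Matrix.neg_mul, Matrix.mul_assoc, Matrix.mul_assoc,
      nonsing_inv_mul _ hdet, Matrix.mul_one]
  have h₂ : W * (B * -(Bᵀ * W⁻¹))ᵀ = -(B * Bᵀ) := by
    simpa [transpose_mul, hWt, Matrix.mul_assoc] using congrArg transpose h₁
  rw [add_mul, transpose_add, mul_add, h₁, h₂]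
  rw [← sub_eq_zero] at h ⊢
  rw [← h]
  abel

end Matrix

/-- An additive map vanishing on all `(y - 1) ^ k * y ^ i` with `k + i = N` vanishes on all
`y ^ i` with `i ≤ N`. -/
theorem map_pow_eq_zero_of_map_sub_one_pow_mul_pow {R M : Type*} [Ring R] [AddCommGroup M]
    (f : R →+ M) (y : R) {N : ℕ} (h : ∀ k i, k + i = N → f ((y - 1) ^ k * y ^ i) = 0)
    {i : ℕ} (hi : i ≤ N) : f (y ^ i) = 0 := by
  have key (j : ℕ) : ∀ k i, k + i + j = N → f ((y - 1) ^ k * y ^ i) = 0 := by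
    induction j with
    | zero => simpa using h
    | succ j ih =>
      intro k i hki
      have hsplit : (y - 1) ^ k * y ^ i =
          (y - 1) ^ k * y ^ (i + 1) - (y - 1) ^ (k + 1) * y ^ i := by
        rw [pow_succ' y, pow_succ (y - 1)]
        noncomm_ring
      rw [hsplit, map_sub, ih k (i + 1) (by lia), ih (k + 1) i (by lia), sub_zero]
  simpa using key (N - i) 0 i (by lia)

/-- A linear map vanishing on the powers of `y` up to `N` vanishes on those of `y + b`. -/
theorem map_add_algebraMap_pow_eq_zero {S R M : Type*} [CommRing S] [Ring R] [Algebra S R]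
    [AddCommGroup M] [Module S M] (f : R →ₗ[S] M) (y : R) (b : S) {N : ℕ}
    (h : ∀ i ≤ N, f (y ^ i) = 0) {i : ℕ} (hi : i ≤ N) : f ((y + algebraMap S R b) ^ i) = 0 := by
  have key (i : ℕ) : ∀ j, j + i ≤ N → f (y ^ j * (y + algebraMap S R b) ^ i) = 0 := by
    induction i with
    | zero => simpa using h
    | succ i ih =>
      intro j hij
      have hsplit : y ^ j * (y + algebraMap S R b) ^ (i + 1) =
          y ^ (j + 1) * (y + algebraMap S R b) ^ i +
            b • (y ^ j * (y + algebraMap S R b) ^ i) := by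
        rw [pow_succ' (y + _), add_mul, mul_add, ← mul_assoc, ← pow_succ, ← Algebra.smul_def,
          mul_smul_comm]
      rw [hsplit, map_add, map_smul, ih (j + 1) (by lia), ih j (by lia), smul_zero, add_zero]
  simpa using key i 0 (by lia)

theorem Matrix.eq_zero_of_vecMul_pow_mul_eq_zero {n r : ℕ} {A : Matrix (Fin n) (Fin n) ℝ}
    {B : Matrix (Fin n) (Fin r) ℝ}
    (hrank : (Matrix.of fun (i : Fin n) (p : Fin n × Fin r) =>
        (A ^ (p.1 : ℕ) * B) i p.2).rank = n)
    {x : Fin n → ℝ} (hx : ∀ k < n, x ᵥ* (A ^ k * B) = 0) : x = 0 := by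
  rw [rank_eq_finrank_span_row] at hrank
  refine vecMul_injective_iff.mpr
    (linearIndependent_iff_card_eq_finrank_span.mpr ((Fintype.card_fin n).trans hrank.symm)) ?_
  ext p
  simpa [vecMul, dotProduct] using congrFun (hx p.1 p.1.2) p.2

theorem Matrix.exists_isUnit_sub_algebraMap_of_lt {n : Type*} [Fintype n] [DecidableEq n]
    (A : Matrix n n ℝ) (a : ℝ) : ∃ b < a, IsUnit (A - algebraMap ℝ _ b) := by
  obtain ⟨b, hb, hbA⟩ := (Set.Iio_infinite a).exists_notMem_finite A.finite_spectrum
  rw [spectrum.notMem_iff] at hbA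
  exact ⟨b, hb, by simpa using hbA.neg⟩

/-- Pole placement / stabilizability: if the controllability matrix
`[B, AB, …, A^{n−1}B]` has rank `n`, then there is a feedback matrix `C` such that all
eigenvalues of `A + BC` have negative real part. -/
theorem stabilizing_feedback_exists (n r : ℕ)
    (A : Matrix (Fin n) (Fin n) ℝ) (B : Matrix (Fin n) (Fin r) ℝ)
    (hrank : (Matrix.of fun (i : Fin n) (p : Fin n × Fin r) =>
        (A ^ (p.1 : ℕ) * B) i p.2).rank = n) :
    ∃ C : Matrix (Fin r) (Fin n) ℝ,
      ∀ μ ∈ spectrum ℂ ((A + B * C).map Complex.ofReal), μ.re < 0 := by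
  obtain ⟨b, hb, hY⟩ := A.exists_isUnit_sub_algebraMap_of_lt (-1)
  set Y := A - algebraMap ℝ (Matrix (Fin n) (Fin n) ℝ) b with hYdef
  have hA : A = Y + algebraMap ℝ _ b := by simp [hYdef]
  obtain ⟨S, hS⟩ := hY.pow n
  set T : Matrix (Fin n) (Fin n) ℝ := ↑S⁻¹ with hT
  have hYT : Commute Y T := by
    have : Commute Y ↑S := hS ▸ Commute.self_pow Y n
    exact this.units_inv_right
  have hTS : T * Y ^ n = 1 := by rw [← hS, hT, Units.inv_mul]
  -- `P k = (Y - 1) ^ k * Y ^ (-1 - k) * B`, so that the sums built from `W` below telescope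
  let F (k : ℕ) := T * ((Y - 1) ^ k * Y ^ (n - k)) * B
  let P (k : ℕ) := T * ((Y - 1) ^ k * Y ^ (n - 1 - k)) * B
  have hYP (k : ℕ) (hk : k < n) : Y * P k = F k := by
    have hc : Commute Y ((Y - 1) ^ k) :=
      ((Commute.refl Y).sub_right (Commute.one_right Y)).pow_right k
    simp only [P, F]
    rw [show n - k = (n - 1 - k) + 1 by lia, pow_succ' Y, ← Matrix.mul_assoc,
      hYT.left_comm, hc.left_comm]
  have hXP (k : ℕ) (hk : k < n) : (Y - 1) * P k = F (k + 1) := by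
    have hc : Commute (Y - 1) T := hYT.sub_left (Commute.one_left T)
    simp only [P, F]
    rw [show n - (k + 1) = n - 1 - k by lia, pow_succ' (Y - 1), ← Matrix.mul_assoc,
      hc.left_comm, mul_assoc (Y - 1)]
  let W := ∑ k ∈ Finset.range n, P k * (P k)ᵀ
  have hself {m : Type} [Fintype m] (M : Matrix (Fin n) m ℝ) : (M * Mᵀ).PosSemidef := by
    simpa using posSemidef_self_mul_conjTranspose M
  have hWps : W.PosSemidef := posSemidef_sum _ fun k _ => hself _
  have hW : W.PosDef := by
    refine .of_dotProduct_mulVec_pos hWps.isHermitian fun x hx =>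
      (hWps.dotProduct_mulVec_nonneg x).lt_of_ne' fun h0 => hx ?_
    have hxP : ∀ k < n, x ᵥ* P k = 0 := by
      simp only [W, sum_mulVec, dotProduct_sum, star_trivial, ← mulVec_mulVec, mulVec_transpose,
        dotProduct_mulVec] at h0
      rw [Finset.sum_eq_zero_iff_of_nonneg fun k _ => by
        simpa using dotProduct_self_star_nonneg (x ᵥ* P k)] at h0
      intro k hk
      exact dotProduct_self_eq_zero.mp (h0 k (Finset.mem_range.mpr hk))
    let f : Matrix (Fin n) (Fin n) ℝ →ₗ[ℝ] (Fin r → ℝ) :=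
      { toFun := fun M => (x ᵥ* T) ᵥ* (M * B)
        map_add' := fun M N => by rw [Matrix.add_mul, vecMul_add]
        map_smul' := fun c M => by rw [Matrix.smul_mul, vecMul_smul, RingHom.id_apply] }
    have hxT : x ᵥ* T = 0 := by
      refine eq_zero_of_vecMul_pow_mul_eq_zero hrank fun k hk => ?_
      rw [hA]
      refine map_add_algebraMap_pow_eq_zero f Y b (N := n - 1) (fun i hi => ?_) (by lia)
      refine map_pow_eq_zero_of_map_sub_one_pow_mul_pow f.toAddMonoidHom Y (fun k i hki => ?_) hi
      have := hxP k (by lia)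
      simp only [P] at this
      rw [show n - 1 - k = i by lia, Matrix.mul_assoc, ← vecMul_vecMul] at this
      exact this
    rw [← vecMul_one x, ← hTS, ← vecMul_vecMul, hxT, zero_vecMul]
  have htel : Y * W * Yᵀ - (Y - 1) * W * (Y - 1)ᵀ = B * Bᵀ - F n * (F n)ᵀ := by
    have hF0 : F 0 = B := by simp [F, hTS]
    calc Y * W * Yᵀ - (Y - 1) * W * (Y - 1)ᵀ
        = ∑ k ∈ Finset.range n, (F k * (F k)ᵀ - F (k + 1) * (F (k + 1))ᵀ) := by
          simp only [W, Finset.mul_sum, Finset.sum_mul, ← Finset.sum_sub_distrib]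
          refine Finset.sum_congr rfl fun k hk => ?_
          rw [← hYP k (Finset.mem_range.mp hk), ← hXP k (Finset.mem_range.mp hk)]
          simp only [transpose_mul, Matrix.mul_assoc]
      _ = B * Bᵀ - F n * (F n)ᵀ := by
          rw [Finset.sum_range_sub' fun k => F k * (F k)ᵀ, hF0]
  refine exists_feedback_of_lyapunov (s := 2 * b + 1) (by linarith) hW (hself (F n)) ?_
  rw [add_sub_assoc, ← htel, hA, Algebra.algebraMap_eq_smul_one]
  simp only [transpose_add, transpose_sub, transpose_smul, transpose_one, add_mul, mul_add, sub_mul,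
    mul_sub, smul_mul_assoc, mul_smul_comm, one_mul, mul_one]
  module
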